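/- Let m be a positive integer with gcd(m,6) = 1, let λ be a positive integer, and let a, b, c, d be integers with ad − bc = 1, m | c, c > 0, and gcd(a,6) = 1. Then s(−d + λc, mc) − s(−d, mc) − λ(1 − a²)/(12m) is an even integer, where s(h,k) = ∑_{r=1}^{k−1} ((r/k) − ⌊r/k⌋ − 1/2)((hr/k) − ⌊hr/k⌋ − 1/2) is the Dedekind sum. -/

import Mathlib

/-- The Dedekind sum `s(h, k) = ∑_{r=1}^{k-1} ((r/k)) ((hr/k))`. -/
noncomputable def dedekindSum (h k : ℤ) : ℚ :=
  ∑ r ∈ Finset.Ico (1 : ℤ) k,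
    (Int.fract ((r : ℚ) / (k : ℚ)) - 1 / 2) *
    (Int.fract ((h : ℚ) * (r : ℚ) / (k : ℚ)) - 1 / 2)


lemma ds_perm {M : Type*} [AddCommMonoid M] (h k : ℤ) (hk : 0 < k) (hc : IsCoprime h k) (φ : ℤ → M) :
    ∑ r ∈ Finset.Ico (1 : ℤ) k, φ ((h * r) % k) = ∑ r ∈ Finset.Ico (1 : ℤ) k, φ r := by
  have hmaps : Set.MapsTo (fun r => (h * r) % k) (Finset.Ico (1 : ℤ) k : Set ℤ) (Finset.Ico (1 : ℤ) k : Set ℤ) := by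
    intro r hr
    simp only [Finset.coe_Ico, Set.mem_Ico] at hr ⊢
    have h1 := Int.emod_nonneg (h * r) hk.ne'
    have h2 := Int.emod_lt_of_pos (h * r) hk
    have h3 : (h * r) % k ≠ 0 := by
      intro h0
      have h4 : k ∣ h * r := Int.dvd_of_emod_eq_zero h0
      have h5 : k ∣ r := hc.symm.dvd_of_dvd_mul_left h4
      have := Int.le_of_dvd (by omega) h5
      omega
    omega
  have hinj : Set.InjOn (fun r => (h * r) % k) (Finset.Ico (1 : ℤ) k : Set ℤ) := by
    intro r hr s hs hrs
    simp only [Finset.coe_Ico, Set.mem_Ico] at hr hs hrs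
    have h4 : k ∣ h * r - h * s := Int.emod_eq_emod_iff_emod_sub_eq_zero.mp hrs |> Int.dvd_of_emod_eq_zero
    rw [← mul_sub] at h4
    have h5 : k ∣ r - s := hc.symm.dvd_of_dvd_mul_left h4
    have := Int.eq_zero_of_abs_lt_dvd h5 (by rw [abs_lt]; omega)
    omega
  refine Finset.sum_nbij (fun r => (h * r) % k) hmaps hinj ?_ (fun _ _ => rfl)
  exact Finset.surjOn_of_injOn_of_card_le _ hmaps hinj le_rfl

/-- The half system. -/
noncomputable def dsHalf (k : ℤ) : Finset ℤ := (Finset.Ico (1 : ℤ) k).filter (fun r => 2 * r < k)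

lemma ds_mem_half (k r : ℤ) : r ∈ dsHalf k ↔ 0 < r ∧ 2 * r < k := by
  simp only [dsHalf, Finset.mem_filter, Finset.mem_Ico]; omega

lemma ds_perm_half {M : Type*} [AddCommMonoid M] (h k : ℤ) (hk : 0 < k) (hc : IsCoprime h k) (φ : ℤ → M) :
    ∑ r ∈ dsHalf k, φ (min ((h * r) % k) (k - (h * r) % k)) = ∑ r ∈ dsHalf k, φ r := by
  have hmaps : Set.MapsTo (fun r => min ((h * r) % k) (k - (h * r) % k)) (dsHalf k : Set ℤ) (dsHalf k : Set ℤ) := by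
    intro r hr
    simp only [Finset.mem_coe, ds_mem_half] at hr ⊢
    have h1 := Int.emod_nonneg (h * r) hk.ne'
    have h2 := Int.emod_lt_of_pos (h * r) hk
    have h3 : ¬ k ∣ 2 * ((h * r) % k) := by
      intro h0
      have h4 : k ∣ h * (2 * r) := by
        have e := Int.emod_add_mul_ediv (h * r) k
        have : h * (2 * r) = 2 * ((h * r) % k) + k * (2 * ((h * r) / k)) := by linear_combination -2 * e
        rw [this]
        exact dvd_add h0 (dvd_mul_right _ _)
      have h5 : k ∣ 2 * r := hc.symm.dvd_of_dvd_mul_left h4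
      have := Int.le_of_dvd (by omega) h5
      omega
    have h6 : (h * r) % k ≠ 0 := fun h0 => h3 (by rw [h0]; simp)
    have h7 : 2 * ((h * r) % k) ≠ k := fun h0 => h3 (by rw [h0])
    omega
  have hinj : Set.InjOn (fun r => min ((h * r) % k) (k - (h * r) % k)) (dsHalf k : Set ℤ) := by
    intro r hr s hs hrs
    simp only [Finset.mem_coe, ds_mem_half] at hr hs hrs
    have er := Int.emod_add_mul_ediv (h * r) k
    have es := Int.emod_add_mul_ediv (h * s) k
    have h0 : (h * r) % k = (h * s) % k ∨ (h * r) % k = k - (h * s) % k := by omega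
    rcases h0 with h0 | h0
    · have h4 : k ∣ h * (r - s) := ⟨(h * r) / k - (h * s) / k, by linear_combination -er + es + h0⟩
      have h5 : k ∣ r - s := hc.symm.dvd_of_dvd_mul_left h4
      have := Int.eq_zero_of_abs_lt_dvd h5 (by rw [abs_lt]; omega)
      omega
    · have h4 : k ∣ h * (r + s) := ⟨(h * r) / k + (h * s) / k + 1, by linear_combination -er - es + h0⟩
      have h5 : k ∣ r + s := hc.symm.dvd_of_dvd_mul_left h4
      have := Int.le_of_dvd (by omega) h5
      omega
  refine Finset.sum_nbij (fun r => min ((h * r) % k) (k - (h * r) % k)) hmaps hinj ?_ (fun _ _ => rfl)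
  exact Finset.surjOn_of_injOn_of_card_le _ hmaps hinj le_rfl

/-- Gauss-type exponent. -/
noncomputable def dsF (k h : ℤ) : ZMod 2 := ∑ r ∈ dsHalf k, (((h * r) / k : ℤ) : ZMod 2)

lemma ds_neg_div (k x : ℤ) (hk : 0 < k) (hx : ¬ k ∣ x) : (-x) / k = - (x / k) - 1 := by
  have e := Int.emod_add_mul_ediv x k
  have h1 := Int.emod_nonneg x hk.ne'
  have h2 := Int.emod_lt_of_pos x hk
  have h3 : x % k ≠ 0 := fun h0 => hx (Int.dvd_of_emod_eq_zero h0)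
  have : -x = (k - x % k) + k * (-(x / k) - 1) := by linear_combination e
  rw [this, Int.add_mul_ediv_left _ _ hk.ne', Int.ediv_eq_zero_of_lt (by omega) (by omega)]
  ring

lemma ds_fold (k h x : ℤ) (hk : 0 < k) (hodd : Odd h) (hx : ¬ k ∣ h * x) :
    (((h * x) / k : ℤ) : ZMod 2) = ((x / k : ℤ) : ZMod 2) +
      (((h * min (x % k) (k - x % k)) / k : ℤ) : ZMod 2) := by
  have e := Int.emod_add_mul_ediv x k
  obtain ⟨j, hj⟩ := hodd
  rw [← Int.cast_add, ZMod.intCast_eq_intCast_iff_dvd_sub]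
  have key : (h * x) / k = (h * (x % k)) / k + h * (x / k) := by
    have : h * x = h * (x % k) + k * (h * (x / k)) := by linear_combination -h * e
    rw [this, Int.add_mul_ediv_left _ _ hk.ne']
  have hx' : ¬ k ∣ h * (x % k) := by
    intro h0
    apply hx
    have : h * x = h * (x % k) + k * (h * (x / k)) := by linear_combination -h * e
    rw [this]
    exact dvd_add h0 (dvd_mul_right _ _)
  rw [key]
  rcases le_total (x % k) (k - x % k) with h1 | h1
  · rw [min_eq_left h1]
    exact ⟨-j * (x / k), by rw [hj]; push_cast; ring⟩
  · rw [min_eq_right h1]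
    have : h * (k - x % k) = -(h * (x % k)) + k * h := by ring
    rw [this, Int.add_mul_ediv_left _ _ hk.ne', ds_neg_div _ _ hk hx']
    generalize h * (x % k) / k = w
    exact ⟨-w + j - j * (x / k), by rw [hj]; push_cast; ring⟩

lemma ds_not_dvd_half (k h r : ℤ) (hc : IsCoprime h k) (hr : r ∈ dsHalf k) : ¬ k ∣ h * r := by
  rw [ds_mem_half] at hr
  intro h0
  have h5 : k ∣ r := hc.symm.dvd_of_dvd_mul_left h0
  have := Int.le_of_dvd (by omega) h5
  omega

lemma dsF_mul (k h g : ℤ) (hk : 0 < k) (hodd : Odd h) (hh : IsCoprime h k) (hg : IsCoprime g k) :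
    dsF k (h * g) = dsF k g + dsF k h := by
  unfold dsF
  rw [← ds_perm_half g k hk hg (fun r => (((h * r) / k : ℤ) : ZMod 2)), ← Finset.sum_add_distrib]
  refine Finset.sum_congr rfl fun r hr => ?_
  have := ds_not_dvd_half k (h * g) r (hh.mul_left hg) hr
  rw [mul_assoc] at this ⊢
  exact ds_fold k h (g * r) hk hodd this

lemma dsF_one (k : ℤ) : dsF k 1 = 0 := by
  unfold dsF
  refine Finset.sum_eq_zero fun r hr => ?_
  rw [ds_mem_half] at hr
  rw [one_mul, Int.ediv_eq_zero_of_lt (by omega) (by omega)]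
  simp

lemma dsF_add (k h t : ℤ) (hk : 0 < k) : dsF k (h + 2 * k * t) = dsF k h := by
  unfold dsF
  refine Finset.sum_congr rfl fun r hr => ?_
  have : (h + 2 * k * t) * r = h * r + k * (2 * t * r) := by ring
  rw [this, Int.add_mul_ediv_left _ _ hk.ne', ZMod.intCast_eq_intCast_iff_dvd_sub]
  exact ⟨-t * r, by push_cast; ring⟩

lemma dsF_pow (k g : ℤ) (hk : 0 < k) (hodd : Odd g) (hg : IsCoprime g k) (n : ℕ) :
    dsF k (g ^ n) = n * dsF k g := by
  induction n with
  | zero => simp [dsF_one]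
  | succ n ih =>
    rw [pow_succ', dsF_mul k g (g ^ n) hk hodd hg hg.pow_left, ih]
    push_cast; ring

lemma ds_pow (w : ℤ) (n : ℕ) : w ^ 2 ∣ (1 + w) ^ n - (1 + n * w) := by
  induction n with
  | zero => simp
  | succ n ih =>
    obtain ⟨t, ht⟩ := ih
    exact ⟨t * (1 + w) + n, by push_cast; linear_combination (1 + w) * ht⟩

/-- Sum of squared quotients. -/
noncomputable def dsQ (k h : ℤ) : ℤ := ∑ r ∈ Finset.Ico (1 : ℤ) k, ((h * r) / k) ^ 2

lemma ds_sum_split (k : ℤ) (φ : ℤ → ℤ) :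
    ∑ r ∈ Finset.Ico (1 : ℤ) k, φ r = ∑ r ∈ dsHalf k, (φ r + φ (k - r)) +
      ∑ r ∈ (Finset.Ico (1 : ℤ) k).filter (fun r => 2 * r = k), φ r := by
  rw [Finset.sum_add_distrib]
  have h1 : ∑ r ∈ dsHalf k, φ (k - r) = ∑ r ∈ (Finset.Ico (1 : ℤ) k).filter (fun r => k < 2 * r), φ r := by
    refine Finset.sum_bij' (fun r _ => k - r) (fun r _ => k - r) ?_ ?_ ?_ ?_ ?_
    · intro r hr; rw [ds_mem_half] at hr; simp only [Finset.mem_filter, Finset.mem_Ico]; omega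
    · intro r hr; rw [ds_mem_half]; simp only [Finset.mem_filter, Finset.mem_Ico] at hr; omega
    · intros; ring
    · intros; ring
    · intros; rfl
  rw [h1, dsHalf, Finset.sum_filter, Finset.sum_filter, Finset.sum_filter, ← Finset.sum_add_distrib,
    ← Finset.sum_add_distrib]
  refine Finset.sum_congr rfl fun r _ => ?_
  rcases lt_trichotomy (2 * r) k with h | h | h
  · rw [if_pos h, if_neg (by omega), if_neg (by omega)]; ring
  · rw [if_neg (by omega), if_neg (by omega), if_pos h]; ring
  · rw [if_neg (by omega), if_pos h, if_neg (by omega)]; ring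

lemma ds_sq4 (x y : ℤ) (h : (2 : ℤ) ∣ x - y) : (4 : ℤ) ∣ x ^ 2 - y ^ 2 := by
  obtain ⟨t, ht⟩ := h
  obtain rfl : x = y + 2 * t := by omega
  exact ⟨t * y + t ^ 2, by ring⟩

lemma dsQ_congr (k h h' : ℤ) (hk : 0 < k) (hodd : Odd h) (hodd' : Odd h')
    (hh : IsCoprime h k) (hh' : IsCoprime h' k) (h4 : (4 : ℤ) ∣ h' - h) (hF : dsF k h' = dsF k h) :
    (4 : ℤ) ∣ dsQ k h' - dsQ k h := by
  have step : ∀ u : ℤ, Odd u → IsCoprime u k → (4 : ℤ) ∣ ∑ r ∈ dsHalf k,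
      (((u * r) / k) ^ 2 + ((u * (k - r)) / k) ^ 2) - 2 * ∑ r ∈ dsHalf k, ((u * r) / k) := by
    intro u hu huk
    rw [Finset.mul_sum, ← Finset.sum_sub_distrib]
    refine Finset.dvd_sum fun r hr => ?_
    have e : u * (k - r) = -(u * r) + k * u := by ring
    rw [e, Int.add_mul_ediv_left _ _ hk.ne', ds_neg_div _ _ hk (ds_not_dvd_half k u r huk hr)]
    obtain ⟨j, rfl⟩ := hu
    generalize (2 * j + 1) * r / k = w
    obtain ⟨v, hv⟩ := (Int.even_mul_pred_self w)
    exact ⟨v + j ^ 2 - j * w, by linear_combination 2 * hv⟩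
  have hF2 : (2 : ℤ) ∣ ∑ r ∈ dsHalf k, ((h' * r) / k) - ∑ r ∈ dsHalf k, ((h * r) / k) := by
    have : ((∑ r ∈ dsHalf k, ((h * r) / k) : ℤ) : ZMod 2) = ((∑ r ∈ dsHalf k, ((h' * r) / k) : ℤ) : ZMod 2) := by
      push_cast; exact hF.symm
    rw [ZMod.intCast_eq_intCast_iff_dvd_sub] at this
    exact_mod_cast this
  have mid : (4 : ℤ) ∣ ∑ r ∈ (Finset.Ico (1 : ℤ) k).filter (fun r => 2 * r = k), ((h' * r) / k) ^ 2 -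
      ∑ r ∈ (Finset.Ico (1 : ℤ) k).filter (fun r => 2 * r = k), ((h * r) / k) ^ 2 := by
    rw [← Finset.sum_sub_distrib]
    refine Finset.dvd_sum fun r hr => ds_sq4 _ _ ?_
    simp only [Finset.mem_filter, Finset.mem_Ico] at hr
    obtain ⟨t, ht⟩ := h4
    have : h' * r = h * r + k * (2 * t) := by
      rw [← hr.2]; linear_combination r * ht
    rw [this, Int.add_mul_ediv_left _ _ hk.ne']
    exact ⟨t, by ring⟩
  unfold dsQ
  rw [ds_sum_split k (fun r => ((h' * r) / k) ^ 2), ds_sum_split k (fun r => ((h * r) / k) ^ 2)]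
  have s1 := step h hodd hh
  have s2 := step h' hodd' hh'
  omega

/-- The sum `∑ r (hr mod k)`. -/
noncomputable def dsS (k h : ℤ) : ℤ := ∑ r ∈ Finset.Ico (1 : ℤ) k, r * ((h * r) % k)

/-- The sum of squares. -/
noncomputable def dsP (k : ℤ) : ℤ := ∑ r ∈ Finset.Ico (1 : ℤ) k, r ^ 2

lemma dsP_eq (k : ℤ) (hk : 0 < k) : 6 * dsP k = k * (k - 1) * (2 * k - 1) := by
  have h1 : (1 : ℤ) ≤ k := hk
  unfold dsP
  induction k, h1 using Int.leInduction with
  | base => simp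
  | succ n hn ih =>
    have : Finset.Ico (1 : ℤ) (n + 1) = insert n (Finset.Ico 1 n) := by
      ext x; simp only [Finset.mem_insert, Finset.mem_Ico]; omega
    rw [this, Finset.sum_insert (by simp), mul_add, ih (by omega)]
    ring

lemma dsS_eq (k h : ℤ) (hk : 0 < k) (hh : IsCoprime h k) :
    2 * h * dsS k h = (1 + h ^ 2) * dsP k - k ^ 2 * dsQ k h := by
  have h1 := ds_perm h k hk hh (fun r => r ^ 2)
  have h2 : (1 + h ^ 2) * dsP k - k ^ 2 * dsQ k h - 2 * h * dsS k h =
      ∑ r ∈ Finset.Ico (1 : ℤ) k, ((h * r) % k) ^ 2 + h ^ 2 * dsP k - k ^ 2 * dsQ k h - 2 * h * dsS k h := by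
    rw [h1]; unfold dsP; ring
  have h3 : ∑ r ∈ Finset.Ico (1 : ℤ) k, ((h * r) % k) ^ 2 + h ^ 2 * dsP k - k ^ 2 * dsQ k h - 2 * h * dsS k h = 0 := by
    unfold dsP dsQ dsS
    rw [Finset.mul_sum, Finset.mul_sum, Finset.mul_sum, ← Finset.sum_add_distrib, ← Finset.sum_sub_distrib,
      ← Finset.sum_sub_distrib]
    refine Finset.sum_eq_zero fun r _ => ?_
    have e := Int.emod_add_mul_ediv (h * r) k
    generalize (h * r) % k = u at *
    generalize (h * r) / k = v at *
    have : k * v = h * r - u := by linear_combination e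
    have h4 : k ^ 2 * v ^ 2 = (h * r - u) ^ 2 := by rw [← this]; ring
    rw [h4]; ring
  linarith

lemma ds_fract (x k : ℤ) (hk : 0 < k) : Int.fract ((x : ℚ) / (k : ℚ)) = ((x % k : ℤ) : ℚ) / k := by
  have e := Int.emod_add_mul_ediv x k
  have hk' : (0 : ℚ) < k := by exact_mod_cast hk
  rw [Int.fract_eq_iff]
  refine ⟨?_, ?_, x / k, ?_⟩
  · have : (0 : ℚ) ≤ ((x % k : ℤ) : ℚ) := by exact_mod_cast Int.emod_nonneg x hk.ne'
    positivity
  · rw [div_lt_one hk']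
    exact_mod_cast Int.emod_lt_of_pos x hk
  · have e' : ((x % k : ℤ) : ℚ) + k * ((x / k : ℤ) : ℚ) = x := by exact_mod_cast e
    rw [← e']
    field_simp
    ring

lemma dedekindSum_eq (h k : ℤ) (hk : 0 < k) : dedekindSum h k =
    ∑ r ∈ Finset.Ico (1 : ℤ) k, ((r : ℚ) / k - 1 / 2) * ((((h * r) % k : ℤ) : ℚ) / k - 1 / 2) := by
  unfold dedekindSum
  refine Finset.sum_congr rfl fun r hr => ?_
  rw [Finset.mem_Ico] at hr
  rw [← Int.cast_mul, ds_fract _ _ hk, ds_fract _ _ hk, Int.emod_eq_of_lt (by omega) hr.2]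

lemma dedekindSum_add (h k t : ℤ) (hk : 0 < k) : dedekindSum (h + k * t) k = dedekindSum h k := by
  rw [dedekindSum_eq _ _ hk, dedekindSum_eq _ _ hk]
  refine Finset.sum_congr rfl fun r _ => ?_
  have : (h + k * t) * r = h * r + k * (t * r) := by ring
  rw [this, Int.add_mul_emod_self_left]

lemma dedekindSum_sub (h h' k : ℤ) (hk : 0 < k) (hh : IsCoprime h k) (hh' : IsCoprime h' k) :
    dedekindSum h' k - dedekindSum h k = ((dsS k h' - dsS k h : ℤ) : ℚ) / (k : ℚ) ^ 2 := by
  have hk' : (k : ℚ) ≠ 0 := by exact_mod_cast hk.ne'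
  have step : ∀ u : ℤ, IsCoprime u k → dedekindSum u k = (dsS k u : ℚ) / (k : ℚ) ^ 2 +
      ∑ r ∈ Finset.Ico (1 : ℤ) k, (1 / 4 - (r : ℚ) / k / 2 - (r : ℚ) / k / 2) := by
    intro u hu
    have p := ds_perm u k hk hu (fun r => (r : ℚ) / k / 2)
    rw [Finset.sum_sub_distrib, ← p, ← Finset.sum_sub_distrib, dedekindSum_eq _ _ hk, dsS, Int.cast_sum,
      Finset.sum_div, ← Finset.sum_add_distrib]
    refine Finset.sum_congr rfl fun r _ => ?_
    rw [Int.cast_mul]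
    field_simp
    ring
  rw [step h hh, step h' hh']
  push_cast
  ring

theorem dedekind_sum_transformation (m : ℤ) (hm : 0 < m) (hm6 : Int.gcd m 6 = 1)
    (lam : ℤ) (hlam : 0 < lam) (a b c d : ℤ) (hdet : a * d - b * c = 1)
    (hmc : m ∣ c) (hc : 0 < c) (ha : Int.gcd a 6 = 1) :
    ∃ n : ℤ,
      dedekindSum (-d + lam * c) (m * c) - dedekindSum (-d) (m * c) -
        (lam : ℚ) * (1 - (a : ℚ) ^ 2) / (12 * (m : ℚ)) = 2 * n := by
  have hk : 0 < m * c := mul_pos hm hc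
  have hm6' : IsCoprime m 6 := Int.isCoprime_iff_gcd_eq_one.mpr hm6
  have hm2 : IsCoprime m 2 := hm6'.of_isCoprime_of_dvd_right (by norm_num)
  have hm3 : IsCoprime m 3 := hm6'.of_isCoprime_of_dvd_right (by norm_num)
  have hm24 : IsCoprime m 24 := by
    have : (24 : ℤ) = 2 ^ 3 * 3 := by norm_num
    rw [this]
    exact (hm2.pow_right).mul_right hm3
  have hmodd : Odd m := by
    rw [← Int.not_even_iff_odd, even_iff_two_dvd]
    intro h
    have := hm2.isUnit_of_dvd' h dvd_rfl
    exact absurd this (by decide)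
  have hdc : IsCoprime d c := ⟨a, -b, by linear_combination hdet⟩
  have hdm : IsCoprime d m := hdc.of_isCoprime_of_dvd_right hmc
  have hdk : IsCoprime d (m * c) := hdm.mul_right hdc
  -- a² ≡ 1 mod 24
  obtain ⟨e, he⟩ : ∃ e : ℤ, 1 - a ^ 2 = 24 * e := by
    have h6 : IsCoprime a 6 := Int.isCoprime_iff_gcd_eq_one.mpr ha
    have h2 : ¬ (2 : ℤ) ∣ a := fun h => absurd (h6.isUnit_of_dvd' h (by norm_num)) (by decide)
    have h3 : ¬ (3 : ℤ) ∣ a := fun h => absurd (h6.isUnit_of_dvd' h (by norm_num)) (by decide)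
    have h8 : (8 : ℤ) ∣ a ^ 2 - 1 := Int.eight_dvd_sq_sub_one_of_odd (by
      rw [← Int.not_even_iff_odd, even_iff_two_dvd]; exact h2)
    have h33 : (3 : ℤ) ∣ a ^ 2 - 1 := by
      have : a % 3 = 1 ∨ a % 3 = 2 := by omega
      rcases this with h | h
      · exact ⟨(a / 3) * (a + 1), by
          have := Int.emod_add_mul_ediv a 3
          rw [h] at this
          linear_combination -(a + 1) * this⟩
      · exact ⟨(a / 3 + 1) * (a - 1), by
          have := Int.emod_add_mul_ediv a 3
          rw [h] at this
          linear_combination -(a - 1) * this⟩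
    have : (24 : ℤ) ∣ 1 - a ^ 2 := by omega
    exact this
  -- odd representative
  obtain ⟨j, hj⟩ : ∃ j : ℤ, Odd (-d + m * c * j) := by
    rcases Int.even_or_odd d with hd | hd
    · refine ⟨1, ?_⟩
      have hcodd : Odd c := by
        rw [← Int.not_even_iff_odd]
        intro hce
        exact absurd (hdc.isUnit_of_dvd' hd.two_dvd hce.two_dvd) (by decide)
      rw [mul_one]
      exact hd.neg.add_odd (hmodd.mul hcodd)
    · refine ⟨0, ?_⟩
      rw [mul_zero, add_zero]
      exact hd.neg
  obtain ⟨h, hh⟩ : ∃ h : ℤ, h = -d + m * c * j := ⟨_, rfl⟩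
  rw [← hh] at hj
  have hhk : IsCoprime h (m * c) := by
    rw [hh]; exact hdk.neg_left.add_mul_left_left j
  have hhm : IsCoprime h m := hhk.of_mul_right_left
  -- choose y
  obtain ⟨y, t, hy⟩ : ∃ y t : ℤ, h * (24 * y) = lam + m * t := by
    obtain ⟨u, v, huv⟩ := (hhm.mul_left hm24.symm)
    exact ⟨u * lam, -v * lam, by linear_combination lam * huv⟩
  obtain ⟨g, hg⟩ : ∃ g : ℤ, g = 1 + 24 * c * y := ⟨_, rfl⟩
  have hgodd : Odd g := ⟨12 * c * y, by rw [hg]; ring⟩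
  have hgc : IsCoprime g c := ⟨1, -(24 * y), by rw [hg]; ring⟩
  have hgk : IsCoprime g (m * c) := (hgc.of_isCoprime_of_dvd_right hmc).mul_right hgc
  have hFg : dsF (m * c) g = 0 := by
    obtain ⟨n, rfl⟩ := Int.eq_ofNat_of_zero_le hm.le
    have hp := dsF_pow ((n : ℤ) * c) g hk hgodd hgk n
    have hn : ((n : ℕ) : ZMod 2) = 1 := by
      have : Odd n := by exact_mod_cast hmodd
      exact (ZMod.natCast_eq_one_iff_odd).mpr this
    rw [hn, one_mul] at hp
    rw [← hp]
    obtain ⟨s, hs⟩ := ds_pow (24 * c * y) n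
    obtain ⟨c', hc'⟩ := hmc
    have : g ^ n = 1 + 2 * ((n : ℤ) * c) * (12 * y + 288 * c' * y ^ 2 * s) := by
      rw [hg]
      linear_combination hs + 576 * c * y ^ 2 * s * hc'
    rw [this, dsF_add _ _ _ hk, dsF_one]
  obtain ⟨h', hh'⟩ : ∃ h' : ℤ, h' = h * g := ⟨_, rfl⟩
  have hh'k : IsCoprime h' (m * c) := by rw [hh']; exact hhk.mul_left hgk
  have hh'odd : Odd h' := by rw [hh']; exact hj.mul hgodd
  have hF : dsF (m * c) h' = dsF (m * c) h := by
    rw [hh', dsF_mul _ _ _ hk hj hhk hgk, hFg, zero_add]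
  obtain ⟨q, hq⟩ := dsQ_congr (m * c) h h' hk hj hh'odd hhk hh'k
    ⟨6 * c * y * h, by rw [hh', hg]; ring⟩ hF
  have e1 : dedekindSum (-d) (m * c) = dedekindSum h (m * c) := by
    rw [hh, dedekindSum_add _ _ _ hk]
  have e2 : dedekindSum (-d + lam * c) (m * c) = dedekindSum h' (m * c) := by
    have : h' = (-d + lam * c) + m * c * (j + t) := by
      rw [hh', hg]; linear_combination hh + c * hy
    rw [this, dedekindSum_add _ _ _ hk]
  have hS := dsS_eq (m * c) h hk hhk
  have hS' := dsS_eq (m * c) h' hk hh'k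
  have hP := dsP_eq (m * c) hk
  -- the congruence mod m
  obtain ⟨z, hz⟩ : m ∣ y * (m * c - 1) * (2 * (m * c) - 1) * (1 - h * h') + h' * e * lam := by
    have hcop : IsCoprime m (24 * h) := hm24.mul_right hhm.symm
    apply hcop.dvd_of_dvd_mul_left
    obtain ⟨c', rfl⟩ := hmc
    have hah : a * h = -1 + m * (-b * c' + a * m * c' * j) := by
      rw [hh]; linear_combination -hdet
    have hgm : h' = h + m * (24 * c' * y * h) := by rw [hh', hg]; ring
    have z1 : h' ≡ h [ZMOD m] := by
      rw [hgm]; exact (Int.modEq_iff_dvd.mpr ⟨-(24 * c' * y * h), by ring⟩)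
    have z2 : a * h ≡ -1 [ZMOD m] := by
      rw [hah]; exact (Int.modEq_iff_dvd.mpr ⟨-(-b * c' + a * m * c' * j), by ring⟩)
    have z3 : h * (24 * y) ≡ lam [ZMOD m] := by
      rw [hy]; exact (Int.modEq_iff_dvd.mpr ⟨-t, by ring⟩)
    have z4 : m * (m * c') ≡ 0 [ZMOD m] := (Int.modEq_zero_iff_dvd.mpr (dvd_mul_right _ _))
    apply Int.modEq_zero_iff_dvd.mp
    calc 24 * h * (y * (m * (m * c') - 1) * (2 * (m * (m * c')) - 1) * (1 - h * h') + h' * e * lam)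
        = h * (24 * y) * (m * (m * c') - 1) * (2 * (m * (m * c')) - 1) * (1 - h * h')
          + h * h' * (24 * e) * lam := by ring
      _ ≡ lam * (0 - 1) * (2 * 0 - 1) * (1 - h * h) + h * h * (24 * e) * lam [ZMOD m] := by
          gcongr
      _ = lam * (1 - (a * h) * (a * h)) := by rw [← he]; ring
      _ ≡ lam * (1 - (-1) * (-1)) [ZMOD m] := by gcongr
      _ = 0 := by ring
  -- main divisibility
  have hmain : 2 * (m * c) ^ 2 ∣ dsS (m * c) h' - dsS (m * c) h - 2 * m * c ^ 2 * e * lam := by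
    have hodd2 : IsCoprime (h * h') (2 * (m * c) ^ 2) := by
      have o : ∀ u : ℤ, Odd u → IsCoprime u 2 := by
        rintro u ⟨v, rfl⟩; exact ⟨1, -v, by ring⟩
      exact ((o _ (hj.mul hh'odd))).mul_right ((hhk.mul_left hh'k).pow_right)
    apply hodd2.symm.dvd_of_dvd_mul_left
    refine ⟨-h * z - h * q + 6 * h * c * y * dsQ (m * c) h, ?_⟩
    have hg2 : h' = h + 24 * c * h * y := by rw [hh', hg]; ring
    refine mul_left_cancel₀ (two_ne_zero (α := ℤ)) ?_
    linear_combination h * hS' - h' * hS - 4 * c * h * y * (1 - h * h') * hP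
      + (-(1 - h * h') * dsP (m * c) + (m * c) ^ 2 * dsQ (m * c) h) * hg2
      - (m * c) ^ 2 * h * hq - 4 * m * c ^ 2 * h * hz
  obtain ⟨n, hn⟩ := hmain
  refine ⟨n, ?_⟩
  rw [e1, e2, dedekindSum_sub _ _ _ hk hhk hh'k]
  have hn' : dsS (m * c) h' - dsS (m * c) h = 2 * m * c ^ 2 * e * lam + 2 * (m * c) ^ 2 * n := by
    linear_combination hn
  rw [hn']
  have heq : (1 : ℚ) - (a : ℚ) ^ 2 = 24 * e := by exact_mod_cast he
  rw [heq]
  have m0 : (m : ℚ) ≠ 0 := by exact_mod_cast hm.ne'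
  have c0 : (c : ℚ) ≠ 0 := by exact_mod_cast hc.ne'
  push_cast
  field_simp
  ring
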